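/- Let B, λ, h be strictly positive real numbers and σ² > 0. Define g : ℝ → ℝ by g(p) = p − λ·B·log₂(1 + p·h/σ²), and set p* = max{λ·B/ln(2) − σ²/h, 0}. Then p* ≥ 0 and for every p ≥ 0, g(p*) ≤ g(p); that is, p* minimizes g over [0, ∞). -/

import Mathlib

/-- The function `p ↦ p - c log (1 + p / a)` is minimized over `[0, ∞)` at `max (c - a) 0`. -/
theorem sub_mul_log_one_add_div_isMinOn {a c : ℝ} (ha : 0 < a) (hc : 0 ≤ c) :
    IsMinOn (fun p : ℝ => p - c * Real.log (1 + p / a)) (Set.Ici 0) (max (c - a) 0) := by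
  intro p hp
  have hp : 0 ≤ p := hp
  change max (c - a) 0 - c * Real.log (1 + max (c - a) 0 / a) ≤ p - c * Real.log (1 + p / a)
  set q := max (c - a) 0 with hq
  have hq0 : 0 ≤ q := le_max_right _ _
  have hqa : 0 < q + a := by linarith
  have hlog : Real.log (1 + p / a) - Real.log (1 + q / a) ≤ (p - q) / (q + a) := by
    rw [← Real.log_div (by positivity) (by positivity)]
    refine (Real.log_le_sub_one_of_pos (by positivity)).trans_eq ?_
    field_simp
    ring
  have hslope : c * ((p - q) / (q + a)) ≤ p - q := by
    rw [← mul_div_assoc, div_le_iff₀ hqa]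
    rcases le_total (c - a) 0 with h | h
    · rw [max_eq_right h] at hq
      rw [hq]
      nlinarith
    · rw [max_eq_left h] at hq
      rw [hq]
      exact le_of_eq (by ring)
  linarith [mul_le_mul_of_nonneg_left hlog hc]

/-- The closed-form water-filling power allocation (equations (20)–(21) of the
paper): for `B, λ, h > 0` and `σ² > 0`, the function
`g(p) = p - λ B log₂(1 + p h / σ²)` is minimized over `[0, ∞)` at
`p* = max (λ B / ln 2 - σ² / h) 0`. -/
theorem water_filling_optimal (B lam h σsq : ℝ)
    (hB : 0 < B) (hlam : 0 < lam) (hh : 0 < h) (hσ : 0 < σsq) :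
    0 ≤ max (lam * B / Real.log 2 - σsq / h) 0 ∧
      ∀ p : ℝ, 0 ≤ p →
        max (lam * B / Real.log 2 - σsq / h) 0
            - lam * B * Real.logb 2 (1 + max (lam * B / Real.log 2 - σsq / h) 0 * h / σsq)
          ≤ p - lam * B * Real.logb 2 (1 + p * h / σsq) := by
  refine ⟨le_max_right _ _, fun p hp => ?_⟩
  have hlog2 : 0 < Real.log 2 := Real.log_pos one_lt_two
  have hrate (x : ℝ) : lam * B * Real.logb 2 (1 + x * h / σsq)
      = lam * B / Real.log 2 * Real.log (1 + x / (σsq / h)) := by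
    rw [Real.logb, div_div_eq_mul_div]
    ring
  rw [hrate, hrate]
  exact sub_mul_log_one_add_div_isMinOn (div_pos hσ hh) (by positivity) hp
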